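/- arXiv:0911.3562 — 6 statements merged into one kernel-verified Lean document; each statement's English description precedes it below -/
import Mathlib

section
/- Let A be a commutative ring and n ≥ 1. Given arbitrary elements ε_J ∈ A indexed by the intervals J of {1,…,n}, define ε*_J := Σ_{P partition of J} (−1)^{|J|−l(P)} ε_P (so in particular ε*_{[i,i]} = ε_{[i,i]}). Then for all 1 ≤ s ≤ t ≤ n both relations hold: Σ_{j=s−1}^{t} (−1)^{j−s+1} ε_{[s,j]} ε*_{[j+1,t]} = 0 and Σ_{j=s−1}^{t} (−1)^{j−s+1} ε*_{[s,j]} ε_{[j+1,t]} = 0. -/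
open Finset

namespace EpsSys

/-- All partitions of the interval `[s,t]` into consecutive blocks `(a,b)` (meaning `{a,…,b}`),
listed left to right; the first argument is fuel. For the empty interval (`t < s`) the only
partition is the empty list. -/
def partitionsAux : ℕ → ℕ → ℕ → List (List (ℕ × ℕ))
  | 0, _, _ => [[]]
  | fuel+1, s, t =>
    if t < s then [[]]
    else (List.range (t + 1 - s)).flatMap fun d =>
      (partitionsAux fuel (s + d + 1) t).map (fun P => (s, s + d) :: P)

/-- The list of all partitions of the interval `[s,t]`. -/
def partitions (s t : ℕ) : List (List (ℕ × ℕ)) :=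
  partitionsAux (t + 1 - s) s t

variable {A : Type*} [CommRing A]

/-- `ε_P`: the product of `ε` over the blocks of a partition `P`. -/
def epsP (eps : ℕ → ℕ → A) (P : List (ℕ × ℕ)) : A :=
  (P.map fun p => eps p.1 p.2).prod

/-- The partition sum `ε*_{[s,t]} = Σ_{P partition of [s,t]} (−1)^{|J| − l(P)} ε_P`.
For the empty interval (`t < s`) this equals `1`. -/
def epsStar (eps : ℕ → ℕ → A) (s t : ℕ) : A :=
  ((partitions s t).map fun P => (-1 : A) ^ (t + 1 - s - P.length) * epsP eps P).sum

/-- Extension of a family indexed by intervals by the convention `ε_∅ = 1`. -/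
def epsE (eps : ℕ → ℕ → A) (s t : ℕ) : A :=
  if t < s then 1 else eps s t

end EpsSys

namespace EpsSys

theorem partitionsAux_eq (s t : ℕ) (fuel : ℕ) (h : t + 1 - s ≤ fuel) :
    partitionsAux fuel s t = partitions s t := by
  have aux : ∀ f₁ f₂ s : ℕ, t + 1 - s ≤ f₁ → t + 1 - s ≤ f₂ →
      partitionsAux f₁ s t = partitionsAux f₂ s t := by
    intro f₁
    induction f₁ with
    | zero =>
      intro f₂ s h₁ _
      cases f₂ with
      | zero => rfl
      | succ f₂ => rw [partitionsAux, partitionsAux, if_pos (by omega)]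
    | succ f₁ ih =>
      intro f₂ s h₁ h₂
      cases f₂ with
      | zero => rw [partitionsAux, partitionsAux, if_pos (by omega)]
      | succ f₂ =>
        rw [partitionsAux, partitionsAux]
        split_ifs with hts
        · rfl
        · congr 1
          funext d
          rw [ih f₂ (s + d + 1) (by omega) (by omega)]
  exact aux _ _ _ h le_rfl

theorem partitions_of_lt {s t : ℕ} (h : t < s) : partitions s t = [[]] := by
  rw [partitions, show t + 1 - s = 0 by omega, partitionsAux]

theorem partitions_of_le {s t : ℕ} (h : s ≤ t) :
    partitions s t = (List.range (t + 1 - s)).flatMap fun d =>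
      (partitions (s + d + 1) t).map fun P => (s, s + d) :: P := by
  rw [partitions, show t + 1 - s = (t - s) + 1 by omega, partitionsAux, if_neg (by omega),
    show t + 1 - s = (t - s) + 1 by omega]
  congr 1
  funext d
  rw [partitionsAux_eq _ _ _ (by omega)]

theorem length_le_of_mem_partitions {s t : ℕ} {P : List (ℕ × ℕ)} (hP : P ∈ partitions s t) :
    P.length ≤ t + 1 - s := by
  induction P generalizing s with
  | nil => simp
  | cons p P ih =>
    rcases lt_or_ge t s with h | h
    · simp [partitions_of_lt h] at hP
    · rw [partitions_of_le h] at hP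
      simp only [List.mem_flatMap, List.mem_range, List.mem_map, List.cons.injEq] at hP
      obtain ⟨d, hd, Q, hQ, -, rfl⟩ := hP
      have := ih hQ
      simp only [List.length_cons]
      omega

variable {A : Type*} [CommRing A]

theorem epsStar_of_lt (eps : ℕ → ℕ → A) {s t : ℕ} (h : t < s) : epsStar eps s t = 1 := by
  simp [epsStar, partitions_of_lt h, epsP, show t + 1 - s = 0 by omega]

/-- Splitting off the first block of a partition. -/
theorem epsStar_of_le (eps : ℕ → ℕ → A) {s t : ℕ} (h : s ≤ t) :
    epsStar eps s t =
      ∑ d ∈ range (t + 1 - s), (-1) ^ d * eps s (s + d) * epsStar eps (s + d + 1) t := by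
  have hrange (f : ℕ → A) (m : ℕ) : ∑ d ∈ range m, f d = ((List.range m).map f).sum := rfl
  rw [epsStar, partitions_of_le h, hrange, List.map_flatMap, List.flatMap_def, List.sum_flatten,
    List.map_map]
  congr 1
  refine List.map_congr_left fun d hd => ?_
  rw [List.mem_range] at hd
  simp only [Function.comp_apply]
  rw [epsStar, ← List.sum_map_mul_left, List.map_map]
  congr 1
  refine List.map_congr_left fun P hP => ?_
  have := length_le_of_mem_partitions hP
  simp only [Function.comp_apply, epsP, List.map_cons, List.prod_cons, List.length_cons]
  rw [show t + 1 - s - (P.length + 1) = d + (t + 1 - (s + d + 1) - P.length) by omega, pow_add]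
  ring

theorem sum_epsE_mul_epsStar (eps : ℕ → ℕ → A) {i t : ℕ} (h : i < t) :
    ∑ j ∈ Icc i t, (-1) ^ (j - i) * epsE eps (i + 1) j * epsStar eps (j + 1) t = 0 := by
  rw [← Ico_add_one_right_eq_Icc, sum_Ico_eq_sum_range,
    show t + 1 - i = (t + 1 - (i + 1)) + 1 by omega, sum_range_succ']
  have hterm : ∀ d, (-1) ^ (i + (d + 1) - i) * epsE eps (i + 1) (i + (d + 1)) *
      epsStar eps (i + (d + 1) + 1) t =
      -((-1) ^ d * eps (i + 1) (i + 1 + d) * epsStar eps (i + 1 + d + 1) t) := by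
    intro d
    rw [epsE, if_neg (by omega), show i + (d + 1) - i = d + 1 by omega,
      show i + (d + 1) = i + 1 + d by omega, pow_succ]
    ring
  simp only [hterm, sum_neg_distrib, ← epsStar_of_le eps (show i + 1 ≤ t from h)]
  simp [epsE]

/-- The upper triangular matrix with entries `f i j` for `i ≤ j < m`. -/
def upperMatrix (m : ℕ) (f : ℕ → ℕ → A) : Matrix (Fin m) (Fin m) A :=
  Matrix.of fun i j => if i ≤ j then f i j else 0

theorem upperMatrix_mul_apply (m : ℕ) (f g : ℕ → ℕ → A) (i j : Fin m) :
    (upperMatrix m f * upperMatrix m g) i j = ∑ k ∈ Icc (i : ℕ) j, f i k * g k j := by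
  have hIcc : Icc (i : ℕ) j = (range m).filter fun k => (i : ℕ) ≤ k ∧ k ≤ j := by
    ext k
    simp only [mem_Icc, mem_filter, mem_range]
    omega
  rw [hIcc, sum_filter, sum_range, Matrix.mul_apply]
  refine sum_congr rfl fun k _ => ?_
  simp only [upperMatrix, Matrix.of_apply, ite_and, Fin.le_def]
  split_ifs <;> simp

/-- For triangular arrays, a left convolution inverse is also a right inverse. -/
theorem sum_Icc_mul_comm_eq_zero {f g : ℕ → ℕ → A} (hf : ∀ i, f i i = 1) (hg : ∀ i, g i i = 1)
    (h : ∀ i j, i < j → ∑ k ∈ Icc i j, f i k * g k j = 0) {i j : ℕ} (hij : i < j) :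
    ∑ k ∈ Icc i j, g i k * f k j = 0 := by
  have hfg : upperMatrix (j + 1) f * upperMatrix (j + 1) g = 1 := by
    ext a b
    rw [upperMatrix_mul_apply]
    rcases lt_trichotomy a b with hab | rfl | hab
    · rw [h _ _ hab, Matrix.one_apply_ne hab.ne]
    · simp [hf, hg]
    · rw [Icc_eq_empty (by simpa using hab), sum_empty, Matrix.one_apply_ne hab.ne']
  have hgf := upperMatrix_mul_apply (j + 1) g f ⟨i, by omega⟩ ⟨j, by omega⟩
  rw [mul_eq_one_comm.mp hfg, Matrix.one_apply_ne (by simp [hij.ne])] at hgf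
  exact hgf.symm

theorem sum_epsStar_mul_epsE (eps : ℕ → ℕ → A) {i t : ℕ} (h : i < t) :
    ∑ j ∈ Icc i t, (-1) ^ (j - i) * epsStar eps (i + 1) j * epsE eps (j + 1) t = 0 := by
  have key := sum_Icc_mul_comm_eq_zero (f := fun i j => (-1 : A) ^ (j - i) * epsE eps (i + 1) j)
    (g := fun i j => epsStar eps (i + 1) j) (by simp [epsE])
    (fun i => epsStar_of_lt eps (Nat.lt_succ_self i))
    (fun i j hij => sum_epsE_mul_epsStar eps hij) h
  rw [← mul_zero ((-1 : A) ^ (t - i)), ← key, mul_sum]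
  refine sum_congr rfl fun j hj => ?_
  obtain ⟨hij, hjt⟩ := mem_Icc.mp hj
  have hsq : (-1 : A) ^ (t - j) * (-1) ^ (t - j) = 1 := by
    rw [← mul_pow, neg_one_mul, neg_neg, one_pow]
  rw [show t - i = (j - i) + (t - j) by omega, pow_add]
  linear_combination
    -((-1 : A) ^ (j - i) * epsStar eps (i + 1) j * epsE eps (j + 1) t) * hsq

end EpsSys

open EpsSys

/-- for arbitrary `ε_J` in a commutative ring, defining
`ε*_J := Σ_{P partition of J} (−1)^{|J|−l(P)} ε_P`, both alternating convolution relations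
`Σ_{j=s−1}^{t} (−1)^{j−s+1} ε_{[s,j]} ε*_{[j+1,t]} = 0` and
`Σ_{j=s−1}^{t} (−1)^{j−s+1} ε*_{[s,j]} ε_{[j+1,t]} = 0` hold for all `1 ≤ s ≤ t ≤ n`.
(The exponent `j−s+1` is written as `j+1−s`, which agrees with it for all `j ≥ s−1`.) -/
theorem stmt0 {A : Type*} [CommRing A] (n : ℕ) (hn : 1 ≤ n) (eps : ℕ → ℕ → A)
    (s t : ℕ) (hs : 1 ≤ s) (hst : s ≤ t) (ht : t ≤ n) :
    (∑ j ∈ Finset.Icc (s - 1) t,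
        (-1 : A) ^ (j + 1 - s) * epsE eps s j * epsStar eps (j + 1) t) = 0 ∧
    (∑ j ∈ Finset.Icc (s - 1) t,
        (-1 : A) ^ (j + 1 - s) * epsStar eps s j * epsE eps (j + 1) t) = 0 := by
  obtain ⟨i, rfl⟩ : ∃ i, s = i + 1 := ⟨s - 1, by omega⟩
  simp only [Nat.add_sub_add_right, Nat.add_sub_cancel]
  exact ⟨sum_epsE_mul_epsStar eps hst, sum_epsStar_mul_epsE eps hst⟩
end

section
/- Let X and Y be ε-geometric crystals of type A_n (total-function model) and F : X → Y a map satisfying F(e_i^c x) = e_i^c(F(x)), ε_i^Y(F(x)) = ε_i^X(x) and γ_i^Y(F(x)) = γ_i^X(x) for all i ∈ {1,…,n}, c ∈ ℂˣ and x ∈ X. Then for every interval J: ε_J^Y(F(x)) = ε_J^X(x) and ε*_J^Y(F(x)) = ε*_J^X(x) for all x ∈ X. -/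
open Finset

namespace EpsSys

/-- An `A_n` epsilon system on a set `X` (total-function model): maps `e_i^c : X → X`
(`act i c`) for `i ∈ {1,…,n}`, `c ∈ ℂˣ`, together with functions `ε_J = eps s t` and
`ε*_J = star s t` for every interval `J = [s,t]` (`1 ≤ s ≤ t ≤ n`), satisfying
`ε*_{[i,i]} = ε_{[i,i]}` and the axioms (E1), (E2), (E3). -/
structure EpsSystem (n : ℕ) (X : Type*) where
  /-- the action `e_i^c` -/
  act : ℕ → ℂˣ → X → X
  /-- `ε_{[s,t]}` -/
  eps : ℕ → ℕ → X → ℂ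
  /-- `ε*_{[s,t]}` -/
  star : ℕ → ℕ → X → ℂ
  /-- `ε*_{[i,i]} = ε_{[i,i]}` -/
  star_diag : ∀ i x, 1 ≤ i → i ≤ n → star i i x = eps i i x
  /-- (E1), first half: `ε_J(e_s^c x) = c⁻¹ ε_J(x)` -/
  eps_act_eq : ∀ s t i (c : ℂˣ) x, 1 ≤ s → s ≤ t → t ≤ n → i = s →
    eps s t (act i c x) = (c : ℂ)⁻¹ * eps s t x
  /-- (E1), second half: `ε_J(e_i^c x) = ε_J(x)` for `i ∉ {s−1, s, t+1}` -/
  eps_act_inv : ∀ s t i (c : ℂˣ) x, 1 ≤ s → s ≤ t → t ≤ n → 1 ≤ i → i ≤ n →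
    i ≠ s - 1 → i ≠ s → i ≠ t + 1 →
    eps s t (act i c x) = eps s t x
  /-- (E2), first half: `ε*_J(e_t^c x) = c⁻¹ ε*_J(x)` -/
  star_act_eq : ∀ s t i (c : ℂˣ) x, 1 ≤ s → s ≤ t → t ≤ n → i = t →
    star s t (act i c x) = (c : ℂ)⁻¹ * star s t x
  /-- (E2), second half: `ε*_J(e_i^c x) = ε*_J(x)` for `i ∉ {s−1, t, t+1}` -/
  star_act_inv : ∀ s t i (c : ℂˣ) x, 1 ≤ s → s ≤ t → t ≤ n → 1 ≤ i → i ≤ n →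
    i ≠ s - 1 → i ≠ t → i ≠ t + 1 →
    star s t (act i c x) = star s t x
  /-- (E3): `ε*_J = Σ_{P partition of J} (−1)^{|J|−l(P)} ε_P` -/
  star_partition : ∀ s t x, 1 ≤ s → s ≤ t → t ≤ n →
    star s t x = EpsSys.epsStar (fun a b => eps a b x) s t

end EpsSys

namespace EpsSys

/-- The Cartan matrix of type `A_n` (on indices `1,…,n`). -/
def cartanA (i j : ℕ) : ℤ :=
  if i = j then 2 else if i + 1 = j ∨ j + 1 = i then -1 else 0

/-- An ε-geometric crystal of type `A_n` (total-function model): an epsilon system together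
with nowhere-vanishing functions `γ_j` satisfying `γ_j(e_i^c x) = c^{a_{ij}} γ_j(x)`. -/
structure EpsGeomCrystal (n : ℕ) (X : Type*) extends EpsSystem n X where
  /-- `γ_j` -/
  gam : ℕ → X → ℂ
  gam_ne : ∀ j x, 1 ≤ j → j ≤ n → gam j x ≠ 0
  gam_act : ∀ i j (c : ℂˣ) x, 1 ≤ i → i ≤ n → 1 ≤ j → j ≤ n →
    gam j (act i c x) = (c : ℂ) ^ (cartanA i j) * gam j x

variable {n : ℕ} {X Y : Type*}

/-- `φ_i := ε_i γ_i`. -/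
def phi (S : EpsGeomCrystal n X) (i : ℕ) (x : X) : ℂ := S.eps i i x * S.gam i x

/-- The product epsilon family on `X × Y`:
`ε^{X×Y}_{[s,t]}(x,y) := Σ_{k=s−1}^{t} ε^Y_{[s,k]}(y) ε^X_{[k+1,t]}(x) / Π_{j=s}^{k} γ^X_j(x)`. -/
noncomputable def prodEps (SX : EpsGeomCrystal n X) (SY : EpsGeomCrystal n Y)
    (s t : ℕ) (p : X × Y) : ℂ :=
  ∑ k ∈ Finset.Icc (s - 1) t,
    epsE (fun a b => SY.eps a b p.2) s k * epsE (fun a b => SX.eps a b p.1) (k + 1) t /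
      ∏ j ∈ Finset.Icc s k, SX.gam j p.1

/-- The product starred epsilon family on `X × Y`:
`ε*^{X×Y}_{[s,t]}(x,y) := Σ_{k=s−1}^{t} ε*^X_{[s,k]}(x) ε*^Y_{[k+1,t]}(y) / Π_{j=k+1}^{t} γ^X_j(x)`. -/
noncomputable def prodEpsStar (SX : EpsGeomCrystal n X) (SY : EpsGeomCrystal n Y)
    (s t : ℕ) (p : X × Y) : ℂ :=
  ∑ k ∈ Finset.Icc (s - 1) t,
    epsE (fun a b => SX.star a b p.1) s k * epsE (fun a b => SY.star a b p.2) (k + 1) t /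
      ∏ j ∈ Finset.Icc (k + 1) t, SX.gam j p.1

/-- `γ^{X×Y}_j(x,y) := γ^X_j(x) γ^Y_j(y)`. -/
def prodGam (SX : EpsGeomCrystal n X) (SY : EpsGeomCrystal n Y)
    (j : ℕ) (p : X × Y) : ℂ :=
  SX.gam j p.1 * SY.gam j p.2

/-- The product action `e_i^c` on `X × Y` is defined at `(x,y)` when
`φ_i(x) + ε_i(y) ≠ 0` and `c φ_i(x) + ε_i(y) ≠ 0`. -/
def prodDefined (SX : EpsGeomCrystal n X) (SY : EpsGeomCrystal n Y)
    (i : ℕ) (c : ℂˣ) (p : X × Y) : Prop :=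
  phi SX i p.1 + SY.eps i i p.2 ≠ 0 ∧ (c : ℂ) * phi SX i p.1 + SY.eps i i p.2 ≠ 0

/-- The product action: `e_i^c(x,y) := (e_i^{c₁} x, e_i^{c₂} y)` with
`c₁ = (c φ_i(x) + ε_i(y))/(φ_i(x) + ε_i(y))` and `c₂ = c/c₁`, where it is defined
(and `(x,y)` itself where it is not). -/
noncomputable def prodAct (SX : EpsGeomCrystal n X) (SY : EpsGeomCrystal n Y)
    (i : ℕ) (c : ℂˣ) (p : X × Y) : X × Y :=
  @dite _ (prodDefined SX SY i c p) (Classical.dec _)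
    (fun h =>
      let c1 : ℂˣ := Units.mk0
        (((c : ℂ) * phi SX i p.1 + SY.eps i i p.2) / (phi SX i p.1 + SY.eps i i p.2))
        (div_ne_zero h.2 h.1)
      (SX.act i c1 p.1, SY.act i (c * c1⁻¹) p.2))
    (fun _ => p)

end EpsSys

open EpsSys

namespace EpsSys

theorem le_of_mem_partitionsAux {fuel s t : ℕ} {P : List (ℕ × ℕ)}
    (hP : P ∈ partitionsAux fuel s t) {p : ℕ × ℕ} (hp : p ∈ P) :
    s ≤ p.1 ∧ p.1 ≤ p.2 ∧ p.2 ≤ t := by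
  induction fuel generalizing s P with
  | zero => simp_all [partitionsAux]
  | succ m ih =>
    rw [partitionsAux] at hP
    split_ifs at hP with h
    · simp_all
    · simp only [List.mem_flatMap, List.mem_range, List.mem_map] at hP
      obtain ⟨d, hd, Q, hQ, rfl⟩ := hP
      rcases List.mem_cons.1 hp with rfl | hp
      · dsimp only
        omega
      · have := ih hQ hp
        omega

theorem partitionsAux_of_lt {s t : ℕ} (h : t < s) (fuel : ℕ) :
    partitionsAux fuel s t = [[]] := by
  cases fuel <;> simp [partitionsAux, h]

/-- The last partition of `[s,t]` in the list is the trivial one; all the blocks of the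
others are proper subintervals of `[s,t]`. -/
theorem exists_partitions_eq_append {s t : ℕ} (hst : s ≤ t) :
    ∃ L : List (List (ℕ × ℕ)), partitions s t = L ++ [[(s, t)]] ∧
      ∀ P ∈ L, ∀ p ∈ P, s ≤ p.1 ∧ p.1 ≤ p.2 ∧ p.2 ≤ t ∧ p.2 - p.1 < t - s := by
  obtain ⟨m, rfl⟩ := Nat.exists_eq_add_of_le hst
  have hm : s + m + 1 - s = m + 1 := by omega
  refine ⟨(List.range m).flatMap fun d =>
      (partitionsAux m (s + d + 1) (s + m)).map (fun P => (s, s + d) :: P), ?_, ?_⟩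
  · rw [partitions, hm, partitionsAux, if_neg (by omega), hm, List.range_succ,
      List.flatMap_append]
    simp [partitionsAux_of_lt (Nat.lt_succ_self (s + m))]
  · intro P hP p hp
    simp only [List.mem_flatMap, List.mem_range, List.mem_map] at hP
    obtain ⟨d, hd, Q, hQ, rfl⟩ := hP
    rcases List.mem_cons.1 hp with rfl | hp
    · dsimp only
      omega
    · have := le_of_mem_partitionsAux hQ hp
      omega

/-- If two families agree on the proper subintervals of `[s,t]`, their partition sums differ
only in the term of the trivial partition. -/
theorem epsStar_sub_epsStar {A : Type*} [CommRing A] {f g : ℕ → ℕ → A} {s t : ℕ} (hst : s ≤ t)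
    (hfg : ∀ a b, s ≤ a → a ≤ b → b ≤ t → b - a < t - s → f a b = g a b) :
    epsStar f s t - epsStar g s t = (-1) ^ (t - s) * (f s t - g s t) := by
  obtain ⟨L, hL, hmem⟩ := exists_partitions_eq_append hst
  have hP : ∀ P ∈ L, epsP f P = epsP g P := fun P hP => by
    unfold epsP
    congr 1
    refine List.map_congr_left fun p hp => ?_
    obtain ⟨h1, h2, h3, h4⟩ := hmem P hP p hp
    exact hfg _ _ h1 h2 h3 h4
  have hsum : (L.map fun P => (-1 : A) ^ (t + 1 - s - P.length) * epsP f P) =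
      L.map fun P => (-1 : A) ^ (t + 1 - s - P.length) * epsP g P :=
    List.map_congr_left fun P h => by rw [hP P h]
  have hexp : t + 1 - s - 1 = t - s := by omega
  have htriv : ∀ h : ℕ → ℕ → A, epsP h [(s, t)] = h s t := fun h => by simp [epsP]
  simp only [epsStar, hL, List.map_append, List.sum_append, hsum, List.map_cons, List.map_nil,
    List.sum_cons, List.sum_nil, List.length_cons, List.length_nil, zero_add, hexp, htriv]
  ring

end EpsSys

/-- a homomorphism of ε-geometric crystals of type `A_n` (a map commuting with
all `e_i^c` and preserving the functions `ε_i` and `γ_i`) preserves the whole epsilon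
systems: `ε_J^Y(F(x)) = ε_J^X(x)` and `ε*_J^Y(F(x)) = ε*_J^X(x)` for every interval `J`. -/
theorem stmt9 (n : ℕ) (hn : 1 ≤ n) {X Y : Type*}
    (SX : EpsGeomCrystal n X) (SY : EpsGeomCrystal n Y) (F : X → Y)
    (hact : ∀ (i : ℕ) (c : ℂˣ) (x : X), 1 ≤ i → i ≤ n →
      F (SX.act i c x) = SY.act i c (F x))
    (heps : ∀ (i : ℕ) (x : X), 1 ≤ i → i ≤ n → SY.eps i i (F x) = SX.eps i i x)
    (hgam : ∀ (i : ℕ) (x : X), 1 ≤ i → i ≤ n → SY.gam i (F x) = SX.gam i x) :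
    ∀ s t : ℕ, 1 ≤ s → s ≤ t → t ≤ n → ∀ x : X,
      SY.eps s t (F x) = SX.eps s t x ∧ SY.star s t (F x) = SX.star s t x := by
  have main : ∀ m s t : ℕ, t - s = m → 1 ≤ s → s ≤ t → t ≤ n → ∀ x : X,
      SY.eps s t (F x) = SX.eps s t x := by
    intro m
    induction m using Nat.strong_induction_on with
    | _ m ih =>
      intro s t hm hs hst ht x
      rcases hst.eq_or_lt with rfl | hlt
      · exact heps s x hs ht
      have hdiff : ∀ z : X, SY.star s t (F z) - SX.star s t z =
          (-1) ^ (t - s) * (SY.eps s t (F z) - SX.eps s t z) := fun z => by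
        rw [SY.star_partition s t _ hs hst ht, SX.star_partition s t _ hs hst ht]
        exact epsStar_sub_epsStar hst fun a b ha hab hb hlen =>
          ih (b - a) (hm ▸ hlen) a b rfl (hs.trans ha) hab (hb.trans ht) z
      let c : ℂˣ := Units.mk0 2 two_ne_zero
      have hc := hdiff (SX.act s c x)
      have hsn : s ≤ n := hst.trans ht
      rw [hact s c x hs hsn,
        SY.star_act_inv s t s c _ hs hst ht hs hsn (by omega) (by omega) (by omega),
        SX.star_act_inv s t s c _ hs hst ht hs hsn (by omega) (by omega) (by omega),
        SY.eps_act_eq s t s c _ hs hst ht rfl, SX.eps_act_eq s t s c _ hs hst ht rfl,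
        hdiff x] at hc
      have hcancel := mul_left_cancel₀ (pow_ne_zero _ (neg_ne_zero.2 one_ne_zero)) hc
      have hc2 : (c : ℂ) = 2 := rfl
      rw [hc2] at hcancel
      linear_combination 2 * hcancel
  intro s t hs hst ht x
  refine ⟨main _ s t rfl hs hst ht x, ?_⟩
  rw [← sub_eq_zero, SY.star_partition s t _ hs hst ht, SX.star_partition s t _ hs hst ht,
    epsStar_sub_epsStar hst fun a b ha hab hb _ =>
      main _ a b rfl (hs.trans ha) hab (hb.trans ht) x,
    main _ s t rfl hs hst ht x, sub_self, mul_zero]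
end

section
/- On B_L define, for every interval [s,t] ⊆ {1,…,n}, ε_{[s,t]}(l) := l_{s+1} l_{s+2} ⋯ l_{t+1}, ε*_{[s,t]}(l) := 0 for s < t, and ε*_{[i,i]}(l) := ε_{[i,i]}(l) = l_{i+1}. Then this family is an A_n epsilon system for the maps e_i^c (1 ≤ i ≤ n): (E1) ε_{[s,t]}(e_i^c l) = c⁻¹ ε_{[s,t]}(l) if i = s and ε_{[s,t]}(e_i^c l) = ε_{[s,t]}(l) if i ∉ {s−1, s, t+1}; (E2) ε*_{[s,t]}(e_i^c l) = c⁻¹ ε*_{[s,t]}(l) if i = t and ε*_{[s,t]}(e_i^c l) = ε*_{[s,t]}(l) if i ∉ {s−1, t, t+1}; and (E3) for every interval J = [s,t] with s < t, Σ_{P partition of J} (−1)^{|J|−l(P)} Π_{[a,b]∈P} (l_{a+1}⋯l_{b+1}) = 0. -/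
open Finset

namespace EpsSys

/-- The action `e_i^c` on `B_L ⊂ (ℂˣ)^{n+1}` (tuples encoded as functions `ℕ → ℂ`,
1-based entries): it multiplies the `i`-th entry by `c` and the `(i+1)`-st by `c⁻¹`. -/
noncomputable def eB (i : ℕ) (c : ℂ) (l : ℕ → ℂ) : ℕ → ℂ := fun j =>
  if j = i then c * l j else if j = i + 1 then c⁻¹ * l j else l j

/-- `ε_{[s,t]}(l) := l_{s+1} l_{s+2} ⋯ l_{t+1}`. -/
noncomputable def epsB (l : ℕ → ℂ) (s t : ℕ) : ℂ :=
  ∏ j ∈ Finset.Icc (s + 1) (t + 1), l j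

/-- `ε*_{[s,t]}(l) := 0` for `s < t`, and `ε*_{[i,i]}(l) := ε_{[i,i]}(l) = l_{i+1}`. -/
noncomputable def epsBstar (l : ℕ → ℂ) (s t : ℕ) : ℂ :=
  if s < t then 0 else l (s + 1)

end EpsSys

open EpsSys

namespace EpsSys

theorem length_le_of_mem_partitionsAux (f : ℕ) :
    ∀ s t : ℕ, ∀ P ∈ partitionsAux f s t, P.length ≤ t + 1 - s := by
  induction f with
  | zero => simp [partitionsAux]
  | succ f ih =>
    intro s t P hP
    rw [partitionsAux] at hP
    split_ifs at hP with h
    · simp_all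
    · simp only [List.mem_flatMap, List.mem_range, List.mem_map] at hP
      obtain ⟨d, hd, Q, hQ, rfl⟩ := hP
      have := ih _ _ Q hQ
      simp only [List.length_cons]
      omega

/-- The partition sum with sign `(-1)^{l(P)}`, with explicit fuel. -/
def signedPartitionSum {A : Type*} [CommRing A] (eps : ℕ → ℕ → A) (f s t : ℕ) : A :=
  ((partitionsAux f s t).map fun P => (-1 : A) ^ P.length * epsP eps P).sum

theorem epsStar_eq_signedPartitionSum {A : Type*} [CommRing A] (eps : ℕ → ℕ → A) (s t : ℕ) :
    epsStar eps s t = (-1) ^ (t + 1 - s) * signedPartitionSum eps (t + 1 - s) s t := by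
  rw [epsStar, signedPartitionSum, partitions, ← List.sum_map_mul_left]
  congr 1
  refine List.map_congr_left fun P hP => ?_
  obtain ⟨k, hk⟩ := Nat.exists_eq_add_of_le (length_le_of_mem_partitionsAux _ _ _ P hP)
  rw [hk, Nat.add_sub_cancel_left, ← mul_assoc, ← pow_add,
    show P.length + k + P.length = k + 2 * P.length by ring, pow_add _ k, pow_mul]
  simp

theorem signedPartitionSum_succ {A : Type*} [CommRing A] (eps : ℕ → ℕ → A) (f s t : ℕ)
    (h : s ≤ t) :
    signedPartitionSum eps (f + 1) s t =
      -∑ d ∈ Finset.range (t + 1 - s),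
        eps s (s + d) * signedPartitionSum eps f (s + d + 1) t := by
  rw [signedPartitionSum, partitionsAux, if_neg h.not_gt, List.map_flatMap, List.flatMap_def,
    List.sum_flatten, List.map_map,
    ← Finset.sum_neg_distrib]
  rw [Finset.sum_eq_multiset_sum, Finset.range_val, Multiset.range, Multiset.map_coe,
    Multiset.sum_coe]
  congr 1
  refine List.map_congr_left fun d _ => ?_
  rw [Function.comp_apply, signedPartitionSum, List.map_map, ← neg_mul, ← List.sum_map_mul_left]
  congr 1
  refine List.map_congr_left fun P _ => ?_
  simp only [Function.comp_apply, epsP, List.map_cons, List.prod_cons, List.length_cons]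
  ring

theorem epsB_succ (l : ℕ → ℂ) {s t : ℕ} (h : s ≤ t) :
    epsB l s (t + 1) = epsB l s t * l (t + 2) :=
  Finset.prod_Icc_succ_top (by omega) l

theorem signedPartitionSum_epsB (l : ℕ → ℂ) (f : ℕ) : ∀ s t : ℕ, t + 1 - s ≤ f →
    signedPartitionSum (epsB l) f s t =
      if t < s then 1 else if s = t then -l (s + 1) else 0 := by
  induction f with
  | zero =>
    intro s t h
    rw [if_pos (by omega)]
    simp [signedPartitionSum, partitionsAux, epsP]
  | succ f ih =>
    intro s t h
    rcases lt_trichotomy t s with hts | rfl | hst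
    · simp [signedPartitionSum, partitionsAux, epsP, hts]
    · rw [signedPartitionSum_succ _ _ _ _ le_rfl]
      simp [ih (t + 1) t (by omega), epsB]
    · obtain ⟨k, rfl⟩ := Nat.exists_eq_add_of_lt hst
      rw [signedPartitionSum_succ _ _ _ _ hst.le, if_neg hst.not_gt, if_neg hst.ne,
        show s + k + 1 + 1 - s = k + 1 + 1 by omega, Finset.sum_range_succ,
        Finset.sum_range_succ, Finset.sum_eq_zero, ih _ _ (by omega), ih _ _ (by omega),
        if_neg (by omega), if_pos (by omega), if_pos (by omega), ← add_assoc,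
        epsB_succ l (by omega)]
      · ring
      · intro d hd
        rw [Finset.mem_range] at hd
        rw [ih _ _ (by omega), if_neg (by omega), if_neg (by omega), mul_zero]

theorem epsStar_epsB_eq_zero (l : ℕ → ℂ) {s t : ℕ} (h : s < t) : epsStar (epsB l) s t = 0 := by
  rw [epsStar_eq_signedPartitionSum, signedPartitionSum_epsB l _ s t le_rfl,
    if_neg h.not_gt, if_neg h.ne, mul_zero]

theorem epsB_eB_self (l : ℕ → ℂ) (c : ℂ) {s t : ℕ} (h : s ≤ t) :
    epsB (eB s c l) s t = c⁻¹ * epsB l s t := by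
  have hs : s + 1 ∈ Finset.Icc (s + 1) (t + 1) := by simp [h]
  rw [epsB, epsB, ← Finset.mul_prod_erase _ _ hs, ← Finset.mul_prod_erase _ l hs, ← mul_assoc]
  congr 1
  · simp [eB]
  · refine Finset.prod_congr rfl fun j hj => ?_
    simp only [Finset.mem_erase, Finset.mem_Icc] at hj
    rw [eB, if_neg (by omega), if_neg (by omega)]

theorem epsB_eB_of_notMem (l : ℕ → ℂ) (c : ℂ) {s t i : ℕ} (h : i < s ∨ t + 1 < i) :
    epsB (eB i c l) s t = epsB l s t := by
  refine Finset.prod_congr rfl fun j hj => ?_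
  rw [Finset.mem_Icc] at hj
  rw [eB, if_neg (by omega), if_neg (by omega)]

theorem epsB_eB_of_mem (l : ℕ → ℂ) {c : ℂ} (hc : c ≠ 0) {s t i : ℕ} (hs : s < i) (ht : i ≤ t) :
    epsB (eB i c l) s t = epsB l s t := by
  have hi : i ∈ Finset.Icc (s + 1) (t + 1) := by rw [Finset.mem_Icc]; omega
  have hi' : i + 1 ∈ (Finset.Icc (s + 1) (t + 1)).erase i := by
    rw [Finset.mem_erase, Finset.mem_Icc]; omega
  rw [epsB, epsB, ← Finset.mul_prod_erase _ _ hi, ← Finset.mul_prod_erase _ l hi,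
    ← Finset.mul_prod_erase _ _ hi', ← Finset.mul_prod_erase _ l hi', ← mul_assoc, ← mul_assoc]
  congr 1
  · simp only [eB, if_pos, if_neg (Nat.succ_ne_self i)]
    field_simp
  · refine Finset.prod_congr rfl fun j hj => ?_
    simp only [Finset.mem_erase, Finset.mem_Icc] at hj
    rw [eB, if_neg (by omega), if_neg (by omega)]

end EpsSys

/-- on `B_L` the family `ε_{[s,t]}(l) = l_{s+1}⋯l_{t+1}`,
`ε*_{[s,t]}(l) = 0` (`s < t`), `ε*_{[i,i]}(l) = l_{i+1}`, is an `A_n` epsilon system for the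
maps `e_i^c`: it satisfies (E1), (E2), and (E3), the latter amounting to
`Σ_{P partition of J} (−1)^{|J|−l(P)} Π_{[a,b]∈P} (l_{a+1}⋯l_{b+1}) = 0` for `s < t`. -/
theorem stmt15 (n : ℕ) (hn : 1 ≤ n) (L : ℂ) (hL : L ≠ 0) (l : ℕ → ℂ)
    (hl : ∀ j : ℕ, 1 ≤ j → j ≤ n + 1 → l j ≠ 0)
    (hprod : ∏ j ∈ Finset.Icc 1 (n + 1), l j = L) :
    ∀ s t i : ℕ, ∀ c : ℂˣ, 1 ≤ s → s ≤ t → t ≤ n → 1 ≤ i → i ≤ n →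
      ((i = s → epsB (eB i (c : ℂ) l) s t = (c : ℂ)⁻¹ * epsB l s t) ∧
       (i ≠ s - 1 → i ≠ s → i ≠ t + 1 → epsB (eB i (c : ℂ) l) s t = epsB l s t) ∧
       (i = t → epsBstar (eB i (c : ℂ) l) s t = (c : ℂ)⁻¹ * epsBstar l s t) ∧
       (i ≠ s - 1 → i ≠ t → i ≠ t + 1 → epsBstar (eB i (c : ℂ) l) s t = epsBstar l s t) ∧
       (s < t → epsStar (epsB l) s t = 0)) := by
  intro s t i c _ hst _ _ _
  refine ⟨?_, fun _ _ _ => ?_, ?_, fun _ _ _ => ?_, epsStar_epsB_eq_zero l⟩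
  · rintro rfl
    exact epsB_eB_self l c hst
  · by_cases hi : s < i ∧ i ≤ t
    · exact epsB_eB_of_mem l c.ne_zero hi.1 hi.2
    · exact epsB_eB_of_notMem l c (by omega)
  · rintro rfl
    rw [epsBstar, epsBstar]
    split_ifs with h
    · simp
    · obtain rfl : s = i := by omega
      simp [eB]
  · rw [epsBstar, epsBstar]
    split_ifs with h
    · rfl
    · rw [eB, if_neg (by omega), if_neg (by omega)]
end

section
/- Let n ≥ 1, L, M ∈ ℂˣ, l ∈ B_L and m ∈ B_M with P_i(l,m) ≠ 0 for all i, and set (l′, m′) := R(l,m), i.e. l′_i = m_i P_i(l,m)/P_{i−1}(l,m) and m′_i = l_i P_{i−1}(l,m)/P_i(l,m). Then l′_i m′_i = l_i m_i for all i, l′₁ l′₂ ⋯ l′_{n+1} = M, and m′₁ m′₂ ⋯ m′_{n+1} = L; that is, R maps B_L × B_M into B_M × B_L. -/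
namespace EpsSys

variable (n : ℕ)

/-- Cyclic reduction of an index to the range `{1,…,n+1}` (indices read modulo `n+1`). -/
def cyc (a : ℕ) : ℕ := (a - 1) % (n + 1) + 1

/-- `P_i(l,m) := Σ_{k=1}^{n+1} (Π_{j=k}^{n+1} l_{i+j}) (Π_{j=1}^{k} m_{i+j})`,
all indices read modulo `n+1` (1-based entries, tuples encoded as functions `ℕ → ℂ`). -/
noncomputable def Pfun (l m : ℕ → ℂ) (i : ℕ) : ℂ :=
  ∑ k ∈ Finset.Icc 1 (n + 1),
    (∏ j ∈ Finset.Icc k (n + 1), l (cyc n (i + j))) *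
      (∏ j ∈ Finset.Icc 1 k, m (cyc n (i + j)))

/-- First component of the tropical R map: `l′_i := m_i P_i(l,m)/P_{i−1}(l,m)`. -/
noncomputable def Rl (l m : ℕ → ℂ) (i : ℕ) : ℂ :=
  m i * Pfun n l m i / Pfun n l m (i - 1)

/-- Second component of the tropical R map: `m′_i := l_i P_{i−1}(l,m)/P_i(l,m)`. -/
noncomputable def Rm (l m : ℕ → ℂ) (i : ℕ) : ℂ :=
  l i * Pfun n l m (i - 1) / Pfun n l m i

end EpsSys

open EpsSys

theorem EpsSys.cyc_add_period (n a : ℕ) (ha : 1 ≤ a) : cyc n (n + 1 + a) = cyc n a := by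
  unfold cyc
  rw [Nat.add_sub_assoc ha, Nat.add_mod_left]

theorem EpsSys.Pfun_period (n : ℕ) (l m : ℕ → ℂ) : Pfun n l m (n + 1) = Pfun n l m 0 := by
  unfold Pfun
  refine Finset.sum_congr rfl fun k hk => ?_
  rw [Finset.mem_Icc] at hk
  congr 1 <;> refine Finset.prod_congr rfl fun j hj => ?_ <;>
    rw [Finset.mem_Icc] at hj <;> rw [cyc_add_period n j (by lia), Nat.zero_add]

theorem Finset.prod_Icc_one_div_pred {K : Type*} [Field K] (f : ℕ → K) (hf : ∀ i, f i ≠ 0)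
    (N : ℕ) : ∏ i ∈ Finset.Icc 1 N, f i / f (i - 1) = f N / f 0 := by
  induction N with
  | zero => simp [hf]
  | succ N ih =>
    rw [Finset.prod_Icc_succ_top (by lia), ih, Nat.add_sub_cancel, mul_comm,
      div_mul_div_cancel₀ (hf N)]

/-- for `l ∈ B_L`, `m ∈ B_M` with all `P_i(l,m) ≠ 0`, the image
`(l′,m′) := R(l,m)` satisfies `l′_i m′_i = l_i m_i` (and `l′_i, m′_i ≠ 0`) for all `i`,
`l′₁⋯l′_{n+1} = M` and `m′₁⋯m′_{n+1} = L`; that is, `R` maps `B_L × B_M` into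
`B_M × B_L`. -/
theorem stmt16 (n : ℕ) (hn : 1 ≤ n) (L M : ℂ) (hL : L ≠ 0) (hM : M ≠ 0)
    (l m : ℕ → ℂ)
    (hl : ∀ j : ℕ, 1 ≤ j → j ≤ n + 1 → l j ≠ 0)
    (hm : ∀ j : ℕ, 1 ≤ j → j ≤ n + 1 → m j ≠ 0)
    (hlprod : ∏ j ∈ Finset.Icc 1 (n + 1), l j = L)
    (hmprod : ∏ j ∈ Finset.Icc 1 (n + 1), m j = M)
    (hP : ∀ i : ℕ, Pfun n l m i ≠ 0) :
    (∀ i : ℕ, 1 ≤ i → i ≤ n + 1 →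
      Rl n l m i ≠ 0 ∧ Rm n l m i ≠ 0 ∧ Rl n l m i * Rm n l m i = l i * m i) ∧
    (∏ i ∈ Finset.Icc 1 (n + 1), Rl n l m i) = M ∧
    (∏ i ∈ Finset.Icc 1 (n + 1), Rm n l m i) = L := by
  have hprod : ∏ i ∈ Finset.Icc 1 (n + 1), Pfun n l m i / Pfun n l m (i - 1) = 1 := by
    rw [Finset.prod_Icc_one_div_pred _ hP, Pfun_period, div_self (hP 0)]
  refine ⟨fun i h1 h2 => ⟨?_, ?_, ?_⟩, ?_, ?_⟩
  · exact div_ne_zero (mul_ne_zero (hm i h1 h2) (hP i)) (hP _)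
  · exact div_ne_zero (mul_ne_zero (hl i h1 h2) (hP _)) (hP i)
  · have h₁ := hP i
    have h₂ := hP (i - 1)
    unfold Rl Rm
    field_simp
  · simp only [Rl, mul_div_assoc]
    rw [Finset.prod_mul_distrib, hprod, hmprod, mul_one]
  · have hinv (i : ℕ) : Rm n l m i = l i * (Pfun n l m i / Pfun n l m (i - 1))⁻¹ := by
      rw [inv_div, Rm, mul_div_assoc]
    simp only [hinv]
    rw [Finset.prod_mul_distrib, Finset.prod_inv_distrib, hprod, hlprod, inv_one, mul_one]
end

section
/- Let n ≥ 1, L, M ∈ ℂˣ, l ∈ B_L and m ∈ B_M with P_i(l,m) ≠ 0 for all i, and set (l′, m′) := R(l,m). For 1 ≤ s ≤ t ≤ n define F_{[s,t]}(l,m) := Σ_{k=s−1}^{t} (Π_{j=s+1}^{k+1} m_j) · (Π_{j=k+2}^{t+1} l_j) · l_{k+1}/l_s (empty products being 1; this is the product epsilon function ε^{B_L×B_M}_{[s,t]}). Then the epsilon functions are invariant under the tropical R map: F_{[s,t]}(l′, m′) = F_{[s,t]}(l, m) for all 1 ≤ s ≤ t ≤ n. -/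
namespace EpsSys

/-- The product epsilon function `ε^{B_L×B_M}_{[s,t]}`:
`F_{[s,t]}(l,m) := Σ_{k=s−1}^{t} (Π_{j=s+1}^{k+1} m_j)(Π_{j=k+2}^{t+1} l_j)·l_{k+1}/l_s`. -/
noncomputable def Ffun (l m : ℕ → ℂ) (s t : ℕ) : ℂ :=
  ∑ k ∈ Finset.Icc (s - 1) t,
    (∏ j ∈ Finset.Icc (s + 1) (k + 1), m j) *
      (∏ j ∈ Finset.Icc (k + 2) (t + 1), l j) * (l (k + 1) / l s)

end EpsSys

open EpsSys

namespace EpsSys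

theorem cyc_add_period_s18 (n a : ℕ) (ha : 1 ≤ a) : cyc n (a + (n + 1)) = cyc n a := by
  have h : a + (n + 1) - 1 = (a - 1) + (n + 1) := by omega
  simp [cyc, h]

theorem cyc_eq_self (n a : ℕ) (h1 : 1 ≤ a) (h2 : a ≤ n + 1) : cyc n a = a := by
  rw [cyc, Nat.mod_eq_of_lt (by omega)]
  omega

theorem prod_Icc_comp_succ {M : Type*} [CommMonoid M] (a : ℕ → M) (u v : ℕ) :
    ∏ j ∈ Finset.Icc u v, a (j + 1) = ∏ j ∈ Finset.Icc (u + 1) (v + 1), a j := by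
  rw [← Finset.map_add_right_Icc, Finset.prod_map]
  rfl

theorem prod_cyc (n : ℕ) (l : ℕ → ℂ) (i : ℕ) :
    ∏ j ∈ Finset.Icc 1 (n + 1), l (cyc n (i + j)) = ∏ j ∈ Finset.Icc 1 (n + 1), l j := by
  induction i with
  | zero =>
    refine Finset.prod_congr rfl fun j hj => ?_
    rw [Finset.mem_Icc] at hj
    rw [zero_add, cyc_eq_self n j hj.1 hj.2]
  | succ i ih =>
    rw [← ih]
    have h : ∀ j, i + 1 + j = i + (j + 1) := fun j => by omega
    simp only [h]
    rw [prod_Icc_comp_succ (fun j => l (cyc n (i + j))), Finset.prod_Icc_succ_top (by omega),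
      ← Finset.mul_prod_Ioc_eq_prod_Icc (f := fun j => l (cyc n (i + j))) (by omega : 1 ≤ n + 1),
      mul_comm, show i + (n + 1 + 1) = i + 1 + (n + 1) by omega, cyc_add_period_s18 n _ (by omega)]
    rfl

/-- Shifting a periodic pair of sequences changes the cyclic sum by boundary terms only. -/
theorem mul_cyclicSum_shift_sub {R : Type*} [CommRing R] (N : ℕ) (a b : ℕ → R)
    (ha : a (N + 1) = a 1) (hb : b (N + 1) = b 1) :
    b 1 * ∑ k ∈ Finset.Icc 1 N,
        (∏ j ∈ Finset.Icc k N, a (j + 1)) * ∏ j ∈ Finset.Icc 1 k, b (j + 1) -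
      a 1 * ∑ k ∈ Finset.Icc 1 N, (∏ j ∈ Finset.Icc k N, a j) * ∏ j ∈ Finset.Icc 1 k, b j =
      a 1 * b 1 * (∏ j ∈ Finset.Icc 1 N, b j - ∏ j ∈ Finset.Icc 1 N, a j) := by
  let g : ℕ → R := fun k => a 1 * ((∏ j ∈ Finset.Icc k N, a j) * ∏ j ∈ Finset.Icc 1 k, b j)
  have hstep : ∀ k ∈ Finset.Icc 1 N,
      b 1 * ((∏ j ∈ Finset.Icc k N, a (j + 1)) * ∏ j ∈ Finset.Icc 1 k, b (j + 1)) -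
        a 1 * ((∏ j ∈ Finset.Icc k N, a j) * ∏ j ∈ Finset.Icc 1 k, b j) = g (k + 1) - g k := by
    intro k hk
    rw [Finset.mem_Icc] at hk
    have hbk : ∏ j ∈ Finset.Icc 1 (k + 1), b j = b 1 * ∏ j ∈ Finset.Icc (1 + 1) (k + 1), b j :=
      (Finset.mul_prod_Ioc_eq_prod_Icc (f := b) (by omega)).symm
    simp only [g]
    rw [prod_Icc_comp_succ, prod_Icc_comp_succ, Finset.prod_Icc_succ_top (by omega), ha, hbk]
    ring
  have htelescope : ∑ k ∈ Finset.Icc 1 N, (g (k + 1) - g k) = g (N + 1) - g 1 := by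
    rw [← Finset.Ico_add_one_right_eq_Icc, Finset.sum_Ico_sub _ (by omega)]
  rw [Finset.mul_sum, Finset.mul_sum, ← Finset.sum_sub_distrib, Finset.sum_congr rfl hstep,
    htelescope]
  simp only [g]
  rw [Finset.prod_Icc_succ_top (by omega), hb, Finset.Icc_eq_empty (by omega : ¬ N + 1 ≤ N)]
  simp only [Finset.prod_empty, Finset.Icc_self, Finset.prod_singleton]
  ring

theorem mul_Pfun_sub (n : ℕ) (l m : ℕ → ℂ) (i : ℕ) (h1 : 1 ≤ i) (h2 : i ≤ n + 1) :
    m i * Pfun n l m i - l i * Pfun n l m (i - 1) =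
      l i * m i * (∏ j ∈ Finset.Icc 1 (n + 1), m j - ∏ j ∈ Finset.Icc 1 (n + 1), l j) := by
  obtain ⟨p, rfl⟩ : ∃ p, i = p + 1 := ⟨i - 1, by omega⟩
  have hper : cyc n (p + (n + 1 + 1)) = cyc n (p + 1) := by
    rw [← cyc_add_period_s18 n (p + 1) (by omega)]
    congr 1
    omega
  have key := mul_cyclicSum_shift_sub (n + 1) (fun j => l (cyc n (p + j)))
    (fun j => m (cyc n (p + j))) (by simp only [hper]) (by simp only [hper])
  have h : ∀ j, p + 1 + j = p + (j + 1) := fun j => by omega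
  simp only [prod_cyc, cyc_eq_self n (p + 1) h1 h2] at key
  simp only [Pfun, h, Nat.add_sub_cancel]
  exact key

theorem Ffun_pred (l m : ℕ → ℂ) (s : ℕ) (hs : 1 ≤ s) (hl : l s ≠ 0) :
    Ffun l m s (s - 1) = 1 := by
  obtain ⟨p, rfl⟩ : ∃ p, s = p + 1 := ⟨s - 1, by omega⟩
  simp [Ffun, div_self hl]

theorem Ffun_succ (l m : ℕ → ℂ) (s t : ℕ) (h : s ≤ t + 1) :
    Ffun l m s (t + 1) = l (t + 2) *
      (Ffun l m s t + m (t + 2) * ((∏ j ∈ Finset.Icc (s + 1) (t + 1), m j) / l s)) := by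
  have hlast : Finset.Icc (t + 1 + 2) (t + 1 + 1) = ∅ := Finset.Icc_eq_empty (by omega)
  rw [Ffun, Finset.sum_Icc_succ_top (by omega), hlast, Finset.prod_empty, Ffun, mul_add,
    Finset.mul_sum,
    Finset.prod_Icc_succ_top (a := s + 1) (b := t + 1) (by omega)]
  congr 1
  · refine Finset.sum_congr rfl fun k hk => ?_
    rw [Finset.mem_Icc] at hk
    rw [Finset.prod_Icc_succ_top (a := k + 2) (b := t + 1) (by omega)]
    ring
  · ring

/-- Under the R map the epsilon function is preserved, while the accompanying product
`m_{s+1} ⋯ m_{t+1} / l_s` changes by a multiple of it. -/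
theorem Ffun_R (n : ℕ) (l m : ℕ → ℂ) (hl : ∀ j : ℕ, 1 ≤ j → j ≤ n + 1 → l j ≠ 0)
    (hm : ∀ j : ℕ, 1 ≤ j → j ≤ n + 1 → m j ≠ 0) (hP : ∀ i : ℕ, Pfun n l m i ≠ 0)
    (s d : ℕ) (hs : 1 ≤ s) (hd : s + d ≤ n + 1) :
    Ffun (Rl n l m) (Rm n l m) s (s - 1 + d) = Ffun l m s (s - 1 + d) ∧
      (∏ j ∈ Finset.Icc (s + 1) (s + d), Rm n l m j) / Rl n l m s =
        (∏ j ∈ Finset.Icc (s + 1) (s + d), m j) / l s -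
          (∏ j ∈ Finset.Icc 1 (n + 1), m j - ∏ j ∈ Finset.Icc 1 (n + 1), l j) *
            Ffun l m s (s - 1 + d) / Pfun n l m (s + d) := by
  have hls := hl s hs (by omega)
  have hms := hm s hs (by omega)
  induction d with
  | zero =>
    have hRl : Rl n l m s ≠ 0 := div_ne_zero (mul_ne_zero hms (hP _)) (hP _)
    have key := mul_Pfun_sub n l m s hs hd
    have h0 := hP s
    have h1 := hP (s - 1)
    rw [add_zero, Ffun_pred _ _ s hs hRl, Ffun_pred _ _ s hs hls]
    refine ⟨rfl, ?_⟩
    simp only [add_zero, Finset.Icc_eq_empty (by omega : ¬ s + 1 ≤ s), Finset.prod_empty, Rl]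
    field_simp
    linear_combination -key
  | succ d ih =>
    obtain ⟨ihF, ihB⟩ := ih (by omega)
    have key := mul_Pfun_sub n l m (s + d + 1) (by omega) (by omega)
    have h0 := hP (s + d)
    have h1 := hP (s + d + 1)
    have e1 : s - 1 + d + 1 = s + d := by omega
    have e2 : s - 1 + d + 2 = s + d + 1 := by omega
    have hFs := fun l m : ℕ → ℂ => Ffun_succ l m s (s - 1 + d) (by omega)
    simp only [e2, e1] at hFs
    have e3 : s - 1 + (d + 1) = s + d := by omega
    have hprod := fun f : ℕ → ℂ =>
      Finset.prod_Icc_succ_top (a := s + 1) (b := s + d) (by omega) f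
    rw [e3, ← add_assoc, hFs, hFs, hprod, hprod, mul_div_right_comm, mul_div_right_comm, ihF, ihB]
    generalize (∏ j ∈ Finset.Icc (s + 1) (s + d), m j) / l s = B
    generalize Ffun l m s (s - 1 + d) = A
    generalize (∏ j ∈ Finset.Icc 1 (n + 1), m j - ∏ j ∈ Finset.Icc 1 (n + 1), l j) = D at key ⊢
    simp only [Rl, Rm, Nat.add_sub_cancel] at key ⊢
    generalize Pfun n l m (s + d) = p at *
    generalize Pfun n l m (s + d + 1) = q at *
    generalize l (s + d + 1) = x at *
    generalize m (s + d + 1) = y at *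
    constructor
    · field_simp
      linear_combination A * key
    · field_simp
      linear_combination -B * key

end EpsSys

/-- the epsilon functions are invariant under the tropical R map:
for `l ∈ B_L`, `m ∈ B_M` with all `P_i(l,m) ≠ 0` and `(l′,m′) := R(l,m)`,
`F_{[s,t]}(l′,m′) = F_{[s,t]}(l,m)` for all `1 ≤ s ≤ t ≤ n`. -/
theorem stmt18 (n : ℕ) (hn : 1 ≤ n) (L M : ℂ) (hL : L ≠ 0) (hM : M ≠ 0)
    (l m : ℕ → ℂ)
    (hl : ∀ j : ℕ, 1 ≤ j → j ≤ n + 1 → l j ≠ 0)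
    (hm : ∀ j : ℕ, 1 ≤ j → j ≤ n + 1 → m j ≠ 0)
    (hlprod : ∏ j ∈ Finset.Icc 1 (n + 1), l j = L)
    (hmprod : ∏ j ∈ Finset.Icc 1 (n + 1), m j = M)
    (hP : ∀ i : ℕ, Pfun n l m i ≠ 0) :
    ∀ s t : ℕ, 1 ≤ s → s ≤ t → t ≤ n →
      Ffun (fun i => Rl n l m i) (fun i => Rm n l m i) s t = Ffun l m s t := by
  intro s t hs hst ht
  have h := (Ffun_R n l m hl hm hP s (t + 1 - s) hs (by omega)).1
  rwa [show s - 1 + (t + 1 - s) = t by omega] at h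
end

section
/- Let n ≥ 2 and a, b ∈ ℂˣ with a^{n+1} ≠ b^{n+1}. Suppose l′, m′ ∈ (ℂˣ)^{n+1} satisfy: l′₁ l′₂ ⋯ l′_{n+1} = b^{n+1}; m′₁ m′₂ ⋯ m′_{n+1} = a^{n+1}; l′_{i+1} + l′_{i+1} m′_{i+1}/l′_i = a + b for i = 1, …, n; l′_i m′_i = l′_{i+1} m′_{i+1} for i = 1, …, n; and l′_{i+2} m′_{i+2} = ab for i = 1, …, n−1. Then l′_i = b and m′_i = a for all i = 1, …, n+1. (This is the system of equations ε_i(l′,m′) = ε_i(l₀,m₀), γ_i(l′,m′) = 1, ε*_{i,i+1}(l′,m′) = ε*_{i,i+1}(l₀,m₀) arising in the proof that the tropical R map on B_{b^{n+1}} × B_{a^{n+1}} is unique; the hypothesis a^{n+1} ≠ b^{n+1} is needed for uniqueness.) -/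
/-- Closed form for the partial products of a sequence with `l (k+1) = a + b - a * b / l k`,
stated without division. -/
theorem sub_mul_prod_of_recurrence {R : Type*} [CommRing R] (a b : R) (l : ℕ → R) (n : ℕ)
    (h : ∀ i, 1 ≤ i → i ≤ n → l (i + 1) * l i = (a + b) * l i - a * b) :
    ∀ k ≤ n, (a - b) * ∏ j ∈ Finset.Icc 1 (k + 1), l j =
      a ^ (k + 1) * (l 1 - b) - b ^ (k + 1) * (l 1 - a) := by
  have key : ∀ k ≤ n,
      (a - b) * ∏ j ∈ Finset.Icc 1 k, l j = a ^ k * (l 1 - b) - b ^ k * (l 1 - a) ∧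
      (a - b) * ∏ j ∈ Finset.Icc 1 (k + 1), l j =
        a ^ (k + 1) * (l 1 - b) - b ^ (k + 1) * (l 1 - a) := by
    intro k
    induction k with
    | zero =>
      intro _
      constructor
      · simp
      · simp; ring
    | succ k ih =>
      intro hk
      obtain ⟨h₀, h₁⟩ := ih (by lia)
      refine ⟨h₁, ?_⟩
      have hrec := h (k + 1) (by lia) hk
      rw [Finset.prod_Icc_succ_top (by lia)] at h₁
      rw [Finset.prod_Icc_succ_top (by lia), Finset.prod_Icc_succ_top (by lia)]
      linear_combination (a - b) * (∏ j ∈ Finset.Icc 1 k, l j) * hrec + (a + b) * h₁ -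
        a * b * h₀
  exact fun k hk => (key k hk).2

/-- uniqueness of the solution of the system of equations arising in the
proof that the tropical R map on `B_{b^{n+1}} × B_{a^{n+1}}` is unique. For `n ≥ 2` and
`a, b ∈ ℂˣ` with `a^{n+1} ≠ b^{n+1}`, if tuples `l′, m′ ∈ (ℂˣ)^{n+1}` (encoded as
functions `ℕ → ℂ`, 1-based nonzero entries) satisfy `l′₁⋯l′_{n+1} = b^{n+1}`,
`m′₁⋯m′_{n+1} = a^{n+1}`, `l′_{i+1} + l′_{i+1} m′_{i+1}/l′_i = a + b` (`1 ≤ i ≤ n`),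
`l′_i m′_i = l′_{i+1} m′_{i+1}` (`1 ≤ i ≤ n`) and `l′_{i+2} m′_{i+2} = a·b`
(`1 ≤ i ≤ n−1`), then `l′_i = b` and `m′_i = a` for all `1 ≤ i ≤ n+1`. -/
theorem stmt19 (n : ℕ) (hn : 2 ≤ n) (a b : ℂ) (ha : a ≠ 0) (hb : b ≠ 0)
    (hab : a ^ (n + 1) ≠ b ^ (n + 1))
    (l' m' : ℕ → ℂ)
    (hl' : ∀ j : ℕ, 1 ≤ j → j ≤ n + 1 → l' j ≠ 0)
    (hm' : ∀ j : ℕ, 1 ≤ j → j ≤ n + 1 → m' j ≠ 0)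
    (hlprod : ∏ j ∈ Finset.Icc 1 (n + 1), l' j = b ^ (n + 1))
    (hmprod : ∏ j ∈ Finset.Icc 1 (n + 1), m' j = a ^ (n + 1))
    (heq1 : ∀ i : ℕ, 1 ≤ i → i ≤ n →
      l' (i + 1) + l' (i + 1) * m' (i + 1) / l' i = a + b)
    (heq2 : ∀ i : ℕ, 1 ≤ i → i ≤ n → l' i * m' i = l' (i + 1) * m' (i + 1))
    (heq3 : ∀ i : ℕ, 1 ≤ i → i ≤ n - 1 → l' (i + 2) * m' (i + 2) = a * b) :
    ∀ i : ℕ, 1 ≤ i → i ≤ n + 1 → l' i = b ∧ m' i = a := by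
  have hlm : ∀ i, 1 ≤ i → i ≤ n + 1 → l' i * m' i = a * b := by
    intro i hi hin
    obtain rfl | rfl | h3 : i = 1 ∨ i = 2 ∨ 3 ≤ i := by lia
    · rw [heq2 1 le_rfl (by lia), heq2 2 (by lia) hn, heq3 1 le_rfl (by lia)]
    · rw [heq2 2 (by lia) hn, heq3 1 le_rfl (by lia)]
    · obtain ⟨k, rfl⟩ := Nat.exists_eq_add_of_le' (show 2 ≤ i by lia)
      exact heq3 k (by lia) (by lia)
  have hrec : ∀ i, 1 ≤ i → i ≤ n → l' (i + 1) * l' i = (a + b) * l' i - a * b := by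
    intro i hi hin
    have h := heq1 i hi hin
    have h0 := hl' i hi (by lia)
    rw [hlm (i + 1) (by lia) (by lia)] at h
    field_simp at h
    linear_combination h
  have hl1 : l' 1 = b := by
    have h := sub_mul_prod_of_recurrence a b l' n hrec n le_rfl
    rw [hlprod] at h
    have h' : (a ^ (n + 1) - b ^ (n + 1)) * (l' 1 - b) = 0 := by linear_combination -h
    exact sub_eq_zero.mp ((mul_eq_zero.mp h').resolve_left (sub_ne_zero.mpr hab))
  have hl : ∀ i, 1 ≤ i → i ≤ n + 1 → l' i = b := by
    intro i hi
    induction i, hi using Nat.le_induction with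
    | base => exact fun _ => hl1
    | succ k hk ih =>
      intro hkn
      have h := hrec k hk (by lia)
      rw [ih (by lia)] at h
      exact mul_right_cancel₀ hb (by linear_combination h)
  intro i hi hin
  have h := hlm i hi hin
  rw [hl i hi hin] at h
  exact ⟨hl i hi hin, mul_left_cancel₀ hb (by linear_combination h)⟩
end
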